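/- Let Ω ⊆ ℝ² be open, let f : Ω → ℝ³ be a smooth immersion with unit normal N := (f_x × f_y)/‖f_x × f_y‖, suppose the Gauss curvature of f with respect to N is a constant K > 0, and let H denote the mean curvature of f with respect to N. Fix ε ∈ {1, −1} and define the parallel map g := f − (ε/√K)·N. Then g is an immersion at a point p if and only if H(p) ≠ −ε√K, and at every such point p one has ⟨g_x, N⟩ = ⟨g_y, N⟩ = 0 and the mean curvature of g with respect to N at p equals ε·√K/2. -/

import Mathlib

noncomputable section

open Real

/-- Euclidean dot product on `ℝ³`. -/
def dot3 (u v : Fin 3 → ℝ) : ℝ := u 0 * v 0 + u 1 * v 1 + u 2 * v 2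

/-- Cross product on `ℝ³`. -/
def cross3 (u v : Fin 3 → ℝ) : Fin 3 → ℝ :=
  ![u 1 * v 2 - u 2 * v 1, u 2 * v 0 - u 0 * v 2, u 0 * v 1 - u 1 * v 0]

/-- Euclidean norm on `ℝ³`. -/
def norm3 (u : Fin 3 → ℝ) : ℝ := Real.sqrt (dot3 u u)

/-- Partial derivative in the first (x) coordinate direction. -/
def px (f : ℝ × ℝ → Fin 3 → ℝ) (p : ℝ × ℝ) : Fin 3 → ℝ := fderiv ℝ f p (1, 0)

/-- Partial derivative in the second (y) coordinate direction. -/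
def py (f : ℝ × ℝ → Fin 3 → ℝ) (p : ℝ × ℝ) : Fin 3 → ℝ := fderiv ℝ f p (0, 1)

/-- Gauss curvature of `g` with respect to the unit normal field `ν`:
`K = (l·n − m²)/(E·G − F²)`. -/
def GaussK (g ν : ℝ × ℝ → Fin 3 → ℝ) (p : ℝ × ℝ) : ℝ :=
  (dot3 (px (px g) p) (ν p) * dot3 (py (py g) p) (ν p) - dot3 (py (px g) p) (ν p) ^ 2) /
    (dot3 (px g p) (px g p) * dot3 (py g p) (py g p) - dot3 (px g p) (py g p) ^ 2)

/-- Mean curvature of `g` with respect to the unit normal field `ν`: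
`H = (E·n − 2F·m + G·l)/(2(E·G − F²))`. -/
def MeanH (g ν : ℝ × ℝ → Fin 3 → ℝ) (p : ℝ × ℝ) : ℝ :=
  (dot3 (px g p) (px g p) * dot3 (py (py g) p) (ν p)
      - 2 * dot3 (px g p) (py g p) * dot3 (py (px g) p) (ν p)
      + dot3 (py g p) (py g p) * dot3 (px (px g) p) (ν p)) /
    (2 * (dot3 (px g p) (px g p) * dot3 (py g p) (py g p) - dot3 (px g p) (py g p) ^ 2))

theorem dot3_cross3_left (u v : Fin 3 → ℝ) : dot3 u (cross3 u v) = 0 := by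
  simp [dot3, cross3]; ring

theorem dot3_cross3_right (u v : Fin 3 → ℝ) : dot3 v (cross3 u v) = 0 := by
  simp [dot3, cross3]; ring

theorem dot3_smul_right (c : ℝ) (u v : Fin 3 → ℝ) : dot3 u (c • v) = c * dot3 u v := by
  simp [dot3]; ring

theorem dot3_smul_left (c : ℝ) (u v : Fin 3 → ℝ) : dot3 (c • u) v = c * dot3 u v := by
  simp [dot3]; ring

theorem dot3_self_pos {u : Fin 3 → ℝ} (hu : u ≠ 0) : 0 < dot3 u u := by
  by_contra h
  refine hu (funext fun i => ?_)
  unfold dot3 at h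
  have h0 : u 0 = 0 := by nlinarith [sq_nonneg (u 0), sq_nonneg (u 1), sq_nonneg (u 2)]
  have h1 : u 1 = 0 := by nlinarith [sq_nonneg (u 0), sq_nonneg (u 1), sq_nonneg (u 2)]
  have h2 : u 2 = 0 := by nlinarith [sq_nonneg (u 0), sq_nonneg (u 1), sq_nonneg (u 2)]
  fin_cases i <;> assumption

/-- Lagrange's identity. -/
theorem dot3_cross3_self (u v : Fin 3 → ℝ) :
    dot3 (cross3 u v) (cross3 u v) = dot3 u u * dot3 v v - dot3 u v ^ 2 := by
  simp [dot3, cross3]; ring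

theorem norm3_inv_smul_unit {u : Fin 3 → ℝ} (hu : u ≠ 0) :
    dot3 ((norm3 u)⁻¹ • u) ((norm3 u)⁻¹ • u) = 1 := by
  have h := dot3_self_pos hu
  have h2 : norm3 u ^ 2 = dot3 u u := Real.sq_sqrt h.le
  have h3 : norm3 u ≠ 0 := (Real.sqrt_pos.2 h).ne'
  rw [dot3_smul_left, dot3_smul_right, ← h2]
  field_simp

/-- A vector orthogonal to `X × Y ≠ 0` is a combination of `X` and `Y`. -/
theorem exists_combination_of_dot3_cross3_eq_zero {X Y U : Fin 3 → ℝ} (h : cross3 X Y ≠ 0)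
    (hU : dot3 U (cross3 X Y) = 0) : ∃ a b : ℝ, U = a • X + b • Y := by
  have hW : dot3 X X * dot3 Y Y - dot3 X Y ^ 2 ≠ 0 := by
    rw [← dot3_cross3_self]; exact (dot3_self_pos h).ne'
  refine ⟨(dot3 Y Y * dot3 U X - dot3 X Y * dot3 U Y) / (dot3 X X * dot3 Y Y - dot3 X Y ^ 2),
    (dot3 X X * dot3 U Y - dot3 X Y * dot3 U X) / (dot3 X X * dot3 Y Y - dot3 X Y ^ 2), ?_⟩
  have key : ∀ i, (dot3 X X * dot3 Y Y - dot3 X Y ^ 2) * U i =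
      dot3 U (cross3 X Y) * cross3 X Y i + (dot3 Y Y * dot3 U X - dot3 X Y * dot3 U Y) * X i +
        (dot3 X X * dot3 U Y - dot3 X Y * dot3 U X) * Y i := by
    intro i
    fin_cases i <;> simp [dot3, cross3] <;> ring
  funext i
  have := key i
  rw [hU, zero_mul, zero_add] at this
  simp only [Pi.add_apply, Pi.smul_apply, smul_eq_mul]
  generalize dot3 X X * dot3 Y Y - dot3 X Y ^ 2 = W at *
  field_simp
  linear_combination this

theorem fderiv_dot3 {A B : ℝ × ℝ → Fin 3 → ℝ} {p : ℝ × ℝ} (hA : DifferentiableAt ℝ A p)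
    (hB : DifferentiableAt ℝ B p) (v : ℝ × ℝ) :
    fderiv ℝ (fun q => dot3 (A q) (B q)) p v =
      dot3 (fderiv ℝ A p v) (B p) + dot3 (A p) (fderiv ℝ B p v) := by
  have a := fun i => hasFDerivAt_pi'.1 hA.hasFDerivAt i
  have b := fun i => hasFDerivAt_pi'.1 hB.hasFDerivAt i
  have := (((a 0).mul (b 0)).add ((a 1).mul (b 1))).add ((a 2).mul (b 2))
  have h2 : HasFDerivAt (fun q => dot3 (A q) (B q)) _ p := this
  rw [h2.fderiv]
  simp [dot3]
  ring

theorem dot3_fderiv_of_eventually_const {A B : ℝ × ℝ → Fin 3 → ℝ} {p : ℝ × ℝ} {c : ℝ}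
    (hA : DifferentiableAt ℝ A p) (hB : DifferentiableAt ℝ B p)
    (h : ∀ᶠ q in nhds p, dot3 (A q) (B q) = c) (v : ℝ × ℝ) :
    dot3 (fderiv ℝ A p v) (B p) = -dot3 (A p) (fderiv ℝ B p v) := by
  have h1 := fderiv_dot3 hA hB v
  have h2 : (fun q => dot3 (A q) (B q)) =ᶠ[nhds p] fun _ => c := h
  rw [h2.fderiv_eq] at h1
  simp at h1
  linarith

theorem ContDiffAt.fderiv_apply_const {f : ℝ × ℝ → Fin 3 → ℝ} {p : ℝ × ℝ}
    (hf : ContDiffAt ℝ (⊤ : ℕ∞) f p) (v : ℝ × ℝ) :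
    ContDiffAt ℝ (⊤ : ℕ∞) (fun q => fderiv ℝ f q v) p :=
  (hf.fderiv_right (m := (⊤ : ℕ∞)) (by simp)).clm_apply contDiffAt_const

theorem ContDiffAt.unit_cross3 {A B : ℝ × ℝ → Fin 3 → ℝ} {p : ℝ × ℝ}
    (hA : ContDiffAt ℝ (⊤ : ℕ∞) A p) (hB : ContDiffAt ℝ (⊤ : ℕ∞) B p)
    (h : cross3 (A p) (B p) ≠ 0) :
    ContDiffAt ℝ (⊤ : ℕ∞)
      (fun q => (norm3 (cross3 (A q) (B q)))⁻¹ • cross3 (A q) (B q)) p := by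
  have a := contDiffAt_pi.1 hA
  have b := contDiffAt_pi.1 hB
  have hc : ContDiffAt ℝ (⊤ : ℕ∞) (fun q => cross3 (A q) (B q)) p := by
    refine contDiffAt_pi.2 fun i => ?_
    fin_cases i
    · exact ((a 1).mul (b 2)).sub ((a 2).mul (b 1))
    · exact ((a 2).mul (b 0)).sub ((a 0).mul (b 2))
    · exact ((a 0).mul (b 1)).sub ((a 1).mul (b 0))
  have c := contDiffAt_pi.1 hc
  have hd : ContDiffAt ℝ (⊤ : ℕ∞)
      (fun q => dot3 (cross3 (A q) (B q)) (cross3 (A q) (B q))) p :=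
    (((c 0).mul (c 0)).add ((c 1).mul (c 1))).add ((c 2).mul (c 2))
  have hpos := dot3_self_pos h
  exact ((hd.sqrt hpos.ne').inv (Real.sqrt_pos.2 hpos).ne').smul hc

theorem cross3_combination (X Y : Fin 3 → ℝ) (a b d e : ℝ) :
    cross3 (a • X + b • Y) (d • X + e • Y) = (a * e - b * d) • cross3 X Y := by
  funext i
  fin_cases i <;> simp [cross3] <;> ring

theorem dot3_combination (X Y : Fin 3 → ℝ) (a b d e : ℝ) :
    dot3 (a • X + b • Y) (d • X + e • Y) =
      a * d * dot3 X X + (a * e + b * d) * dot3 X Y + b * e * dot3 Y Y := by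
  simp [dot3]; ring

theorem dot3_comm (u v : Fin 3 → ℝ) : dot3 u v = dot3 v u := by
  simp [dot3]; ring

theorem dot3_sub_smul (u v w : Fin 3 → ℝ) (c : ℝ) :
    dot3 (u - c • v) w = dot3 u w - c * dot3 v w := by
  simp [dot3]; ring

/-- The parallel-surface computation at a point: `X, Y` are the tangent vectors of the surface,
`U, V` the derivatives of the unit normal, and `c² K = 1`. -/
theorem parallel_surface_pointwise {X Y U V : Fin 3 → ℝ} {K c H : ℝ} (hXY : cross3 X Y ≠ 0)
    (hU : dot3 U (cross3 X Y) = 0) (hV : dot3 V (cross3 X Y) = 0)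
    (hsym : dot3 X V = dot3 Y U) (hc : c ^ 2 * K = 1)
    (hK : (-dot3 X U * -dot3 Y V - (-dot3 X V) ^ 2) /
      (dot3 X X * dot3 Y Y - dot3 X Y ^ 2) = K)
    (hH : (dot3 X X * -dot3 Y V - 2 * dot3 X Y * -dot3 X V + dot3 Y Y * -dot3 X U) /
      (2 * (dot3 X X * dot3 Y Y - dot3 X Y ^ 2)) = H) :
    (cross3 (X - c • U) (Y - c • V) ≠ 0 ↔ 1 + c * H ≠ 0) ∧
    (1 + c * H ≠ 0 →
      (dot3 (X - c • U) (X - c • U) * -dot3 (Y - c • V) V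
        - 2 * dot3 (X - c • U) (Y - c • V) * -dot3 (X - c • U) V
        + dot3 (Y - c • V) (Y - c • V) * -dot3 (X - c • U) U) /
      (2 * (dot3 (X - c • U) (X - c • U) * dot3 (Y - c • V) (Y - c • V)
        - dot3 (X - c • U) (Y - c • V) ^ 2)) = c * K / 2) := by
  have hW : dot3 X X * dot3 Y Y - dot3 X Y ^ 2 ≠ 0 := by
    rw [← dot3_cross3_self]; exact (dot3_self_pos hXY).ne'
  obtain ⟨a, b, rfl⟩ := exists_combination_of_dot3_cross3_eq_zero hXY hU
  obtain ⟨d, e, rfl⟩ := exists_combination_of_dot3_cross3_eq_zero hXY hV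
  have eX' : X - c • (a • X + b • Y) = (1 - c * a) • X + (-(c * b)) • Y := by module
  have eY' : Y - c • (d • X + e • Y) = (-(c * d)) • X + (1 - c * e) • Y := by module
  have r1 (s t : ℝ) : dot3 X (s • X + t • Y) = s * dot3 X X + t * dot3 X Y := by
    simp [dot3]; ring
  have r2 (s t : ℝ) : dot3 Y (s • X + t • Y) = s * dot3 X Y + t * dot3 Y Y := by
    simp [dot3]; ring
  simp only [r1, r2] at hK hH hsym
  rw [eX', eY', cross3_combination]
  simp only [dot3_combination]
  generalize dot3 X X = E at *
  generalize dot3 X Y = F at *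
  generalize dot3 Y Y = G at *
  have hK' : K = a * e - b * d := by
    rw [← hK, div_eq_iff hW]
    linear_combination (-(d * E + e * F)) * hsym
  have hH' : H = -(a + e) / 2 := by
    rw [← hH, div_eq_iff (by simpa using hW)]
    linear_combination F * hsym
  have hD : (1 - c * a) * (1 - c * e) - -(c * b) * -(c * d) = 2 * (1 + c * H) := by
    rw [hH']; rw [hK'] at hc; linear_combination hc
  refine ⟨by rw [hD]; simp [hXY], fun h => ?_⟩
  have hWg : (((1 - c * a) * (1 - c * a) * E + ((1 - c * a) * -(c * b) + -(c * b) * (1 - c * a)) * F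
      + -(c * b) * -(c * b) * G) * (-(c * d) * -(c * d) * E
      + (-(c * d) * (1 - c * e) + (1 - c * e) * -(c * d)) * F + (1 - c * e) * (1 - c * e) * G)
      - ((1 - c * a) * -(c * d) * E + ((1 - c * a) * (1 - c * e) + -(c * b) * -(c * d)) * F
      + -(c * b) * (1 - c * e) * G) ^ 2) = (2 * (1 + c * H)) ^ 2 * (E * G - F ^ 2) := by
    rw [← hD]; ring
  rw [hWg, div_eq_iff (mul_ne_zero two_ne_zero
    (mul_ne_zero (pow_ne_zero _ (mul_ne_zero two_ne_zero h)) hW))]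
  have hDK : c * K * (2 * (1 + c * H)) = 2 * c * K - (a + e) := by
    rw [hH']; linear_combination (-(a + e)) * hc
  trans (2 * (1 + c * H)) * (E * G - F ^ 2) * (2 * c * K - (a + e))
  · rw [← hD, hK']
    linear_combination ((1 - c * a) * -(c * d) * E
      + ((1 - c * a) * (1 - c * e) + -(c * b) * -(c * d)) * F
      + -(c * b) * (1 - c * e) * G) * hsym
  · rw [← hDK]; ring

/-- the parallel surface `g = f − (ε/√K)·N` of a surface of constant positive
Gauss curvature `K` is immersed exactly where `H ≠ −ε√K`, and there has constant mean
curvature `ε√K/2`. -/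
theorem stmt2 (Ω : Set (ℝ × ℝ)) (hΩ : IsOpen Ω)
    (f N g : ℝ × ℝ → Fin 3 → ℝ)
    (hf : ContDiffOn ℝ (⊤ : ℕ∞) f Ω)
    (himm : ∀ p ∈ Ω, cross3 (px f p) (py f p) ≠ 0)
    (hN : ∀ p ∈ Ω, N p = (norm3 (cross3 (px f p) (py f p)))⁻¹ • cross3 (px f p) (py f p))
    (K : ℝ) (hK : 0 < K)
    (hGauss : ∀ p ∈ Ω, GaussK f N p = K)
    (ε : ℝ) (hε : ε = 1 ∨ ε = -1)
    (hg : ∀ p, g p = f p - (ε / Real.sqrt K) • N p) :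
    ∀ p ∈ Ω,
      (cross3 (px g p) (py g p) ≠ 0 ↔ MeanH f N p ≠ -ε * Real.sqrt K) ∧
      (MeanH f N p ≠ -ε * Real.sqrt K →
        dot3 (px g p) (N p) = 0 ∧ dot3 (py g p) (N p) = 0 ∧
        MeanH g N p = ε * Real.sqrt K / 2) := by
  have hnhds : ∀ p ∈ Ω, ∀ᶠ q in nhds p, q ∈ Ω := fun p hp => hΩ.mem_nhds hp
  have hfs : ∀ p ∈ Ω, ContDiffAt ℝ (⊤ : ℕ∞) f p := fun p hp => hf.contDiffAt (hΩ.mem_nhds hp)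
  have hfd (v : ℝ × ℝ) : ∀ p ∈ Ω, DifferentiableAt ℝ (fun q => fderiv ℝ f q v) p := fun p hp =>
    ((hfs p hp).fderiv_apply_const v).differentiableAt (by simp)
  have hNs : ∀ p ∈ Ω, ContDiffAt ℝ (⊤ : ℕ∞) N p := fun p hp =>
    (((hfs p hp).fderiv_apply_const (1, 0)).unit_cross3
      ((hfs p hp).fderiv_apply_const (0, 1)) (himm p hp)).congr_of_eventuallyEq
        ((hnhds p hp).mono hN)
  have hNd : ∀ p ∈ Ω, DifferentiableAt ℝ N p := fun p hp =>
    (hNs p hp).differentiableAt (by simp)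
  have hgs : ∀ p ∈ Ω, ContDiffAt ℝ (⊤ : ℕ∞) g p := fun p hp => by
    rw [funext hg]
    exact (hfs p hp).sub ((hNs p hp).const_smul (ε / √K))
  have hgd (v : ℝ × ℝ) : ∀ p ∈ Ω, DifferentiableAt ℝ (fun q => fderiv ℝ g q v) p := fun p hp =>
    ((hgs p hp).fderiv_apply_const v).differentiableAt (by simp)
  have hgder (v : ℝ × ℝ) : ∀ p ∈ Ω,
      fderiv ℝ g p v = fderiv ℝ f p v - (ε / √K) • fderiv ℝ N p v := fun p hp => by
    have h := ((hfs p hp).differentiableAt (by simp)).hasFDerivAt.fun_sub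
      ((hNd p hp).hasFDerivAt.fun_const_smul (ε / √K))
    rw [funext hg, h.fderiv]
    simp
  have hNN : ∀ p ∈ Ω, dot3 (N p) (N p) = 1 := fun p hp => by
    rw [hN p hp]; exact norm3_inv_smul_unit (himm p hp)
  have hxN : ∀ p ∈ Ω, dot3 (fderiv ℝ f p (1, 0)) (N p) = 0 := fun p hp => by
    rw [hN p hp, dot3_smul_right]
    exact mul_eq_zero_of_right _ (dot3_cross3_left _ _)
  have hyN : ∀ p ∈ Ω, dot3 (fderiv ℝ f p (0, 1)) (N p) = 0 := fun p hp => by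
    rw [hN p hp, dot3_smul_right]
    exact mul_eq_zero_of_right _ (dot3_cross3_right _ _)
  have hdN (v : ℝ × ℝ) : ∀ p ∈ Ω, dot3 (fderiv ℝ N p v) (N p) = 0 := fun p hp => by
    have := dot3_fderiv_of_eventually_const (hNd p hp) (hNd p hp) ((hnhds p hp).mono hNN) v
    rw [dot3_comm (N p)] at this
    linarith
  have hgxN : ∀ p ∈ Ω, dot3 (fderiv ℝ g p (1, 0)) (N p) = 0 := fun p hp => by
    rw [hgder _ p hp, dot3_sub_smul, hxN p hp, hdN _ p hp]; ring
  have hgyN : ∀ p ∈ Ω, dot3 (fderiv ℝ g p (0, 1)) (N p) = 0 := fun p hp => by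
    rw [hgder _ p hp, dot3_sub_smul, hyN p hp, hdN _ p hp]; ring
  intro p hp
  have hU (v : ℝ × ℝ) : dot3 (fderiv ℝ N p v) (cross3 (px f p) (py f p)) = 0 := by
    have h := hdN v p hp
    rw [hN p hp, dot3_smul_right] at h
    exact (mul_eq_zero.1 h).resolve_left
      (inv_ne_zero (Real.sqrt_pos.2 (dot3_self_pos (himm p hp))).ne')
  have fx (v : ℝ × ℝ) : dot3 (fderiv ℝ (px f) p v) (N p) =
      -dot3 (px f p) (fderiv ℝ N p v) :=
    dot3_fderiv_of_eventually_const (hfd (1, 0) p hp) (hNd p hp)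
    ((hnhds p hp).mono hxN) v
  have fy (v : ℝ × ℝ) : dot3 (fderiv ℝ (py f) p v) (N p) =
      -dot3 (py f p) (fderiv ℝ N p v) :=
    dot3_fderiv_of_eventually_const (hfd (0, 1) p hp) (hNd p hp)
    ((hnhds p hp).mono hyN) v
  have gx (v : ℝ × ℝ) : dot3 (fderiv ℝ (px g) p v) (N p) =
      -dot3 (px g p) (fderiv ℝ N p v) :=
    dot3_fderiv_of_eventually_const (hgd (1, 0) p hp) (hNd p hp)
    ((hnhds p hp).mono hgxN) v
  have gy (v : ℝ × ℝ) : dot3 (fderiv ℝ (py g) p v) (N p) =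
      -dot3 (py g p) (fderiv ℝ N p v) :=
    dot3_fderiv_of_eventually_const (hgd (0, 1) p hp) (hNd p hp)
    ((hnhds p hp).mono hgyN) v
  have hsymm : fderiv ℝ (px f) p (0, 1) = fderiv ℝ (py f) p (1, 0) := by
    unfold px py
    have hd : DifferentiableAt ℝ (fderiv ℝ f) p :=
      ((hfs p hp).fderiv_right (m := (⊤ : ℕ∞)) (by simp)).differentiableAt (by simp)
    have hs : IsSymmSndFDerivAt ℝ f p := (hfs p hp).isSymmSndFDerivAt
      (by rw [minSmoothness_of_isRCLikeNormedField]
          exact WithTop.coe_le_coe.2 (le_top : (2 : ℕ∞) ≤ ⊤))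
    rw [fderiv_clm_apply hd (by fun_prop), fderiv_clm_apply hd (by fun_prop)]
    simpa using hs.eq (0, 1) (1, 0)
  have hsym : dot3 (px f p) (fderiv ℝ N p (0, 1)) = dot3 (py f p) (fderiv ℝ N p (1, 0)) := by
    have h1 := fx (0, 1)
    have h2 := fy (1, 0)
    rw [hsymm] at h1
    linarith
  have hs0 : √K ≠ 0 := (Real.sqrt_pos.2 hK).ne'
  have hsK : √K ^ 2 = K := Real.sq_sqrt hK.le
  have hε2 : ε ^ 2 = 1 := by rcases hε with rfl | rfl <;> norm_num
  have hcK : (ε / √K) ^ 2 * K = 1 := by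
    rw [div_pow, hε2, hsK]; field_simp
  have hG := hGauss p hp
  have hmain := parallel_surface_pointwise (X := px f p) (Y := py f p)
    (U := fderiv ℝ N p (1, 0)) (V := fderiv ℝ N p (0, 1)) (K := K) (c := ε / √K)
    (H := MeanH f N p) (himm p hp) (hU _) (hU _) hsym hcK
    (by rw [← hG, ← fx, ← fx, ← fy]; rfl)
    (by rw [← fx, ← fx, ← fy]; rfl)
  have hiff : 1 + ε / √K * MeanH f N p ≠ 0 ↔ MeanH f N p ≠ -ε * √K := by
    refine not_congr ?_
    field_simp
    constructor
    · intro h; linear_combination ε * h - MeanH f N p * hε2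
    · intro h; rw [h]; linear_combination (-√K) * hε2
  have egx : px g p = px f p - (ε / √K) • fderiv ℝ N p (1, 0) := hgder _ p hp
  have egy : py g p = py f p - (ε / √K) • fderiv ℝ N p (0, 1) := hgder _ p hp
  rw [← hiff]
  refine ⟨by rw [egx, egy]; exact hmain.1, fun h => ⟨hgxN p hp, hgyN p hp, ?_⟩⟩
  have hc2 : ε * √K / 2 = ε / √K * K / 2 := by
    field_simp
    linear_combination ε * hsK
  rw [hc2, ← hmain.2 h, ← egx, ← egy, ← gx, ← gx, ← gy]
  rfl
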